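/- The original operators can be recovered from the modified ones: on flat ℝⁿ, grad = (1/2)·((𝒩+𝒞−3)/(𝒞−1))∘grad~ + (1/(2𝒞))·((𝒩+𝒞−3)/(𝒩+𝒞−1))∘g∘div~ and div = (1/2)·div~∘((𝒩+𝒞−3)/(𝒞−1)) + (1/2)·grad~∘tr∘((𝒩+𝒞−3)/(𝒞(𝒩+𝒞−1))), where all rational functions of the commuting diagonal operators 𝒩, 𝒞 act spectrally (assume n ≥ 5 so all denominators are invertible, since 𝒞 has eigenvalues s+(n−2)/2 ≥ (n−2)/2 > 1). -/

import Mathlib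

open MvPolynomial Finset

/-- Polynomial symmetric tensor fields on flat `ℝⁿ`: polynomials in `x` (Sum.inl)
and auxiliary `y` (Sum.inr) variables. -/
abbrev STF (n : ℕ) := MvPolynomial (Fin n ⊕ Fin n) ℝ

/-- `grad = Σ_μ y_μ ∂/∂x^μ`. -/
noncomputable def oGrad (n : ℕ) : Module.End ℝ (STF n) :=
  ∑ μ : Fin n, (LinearMap.mulLeft ℝ (X (Sum.inr μ))) ∘ₗ (pderiv (Sum.inl μ)).toLinearMap

/-- `div = Σ_μ (∂/∂y_μ)(∂/∂x^μ)`. -/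
noncomputable def oDiv (n : ℕ) : Module.End ℝ (STF n) :=
  ∑ μ : Fin n, (pderiv (Sum.inr μ)).toLinearMap ∘ₗ (pderiv (Sum.inl μ)).toLinearMap

/-- `□ = Σ_μ ∂²/∂(x^μ)²`. -/
noncomputable def oBox (n : ℕ) : Module.End ℝ (STF n) :=
  ∑ μ : Fin n, (pderiv (Sum.inl μ)).toLinearMap ∘ₗ (pderiv (Sum.inl μ)).toLinearMap

/-- Fiberwise Euler operator `N = Σ_μ y_μ ∂/∂y_μ`. -/
noncomputable def oNy (n : ℕ) : Module.End ℝ (STF n) :=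
  ∑ μ : Fin n, (LinearMap.mulLeft ℝ (X (Sum.inr μ))) ∘ₗ (pderiv (Sum.inr μ)).toLinearMap

/-- Fiberwise multiplication `g = (Σ_μ y_μ²)·`. -/
noncomputable def oGy (n : ℕ) : Module.End ℝ (STF n) :=
  LinearMap.mulLeft ℝ (∑ μ : Fin n, X (Sum.inr μ) ^ 2)

/-- Fiberwise trace `tr = Σ_μ ∂²/∂y_μ²`. -/
noncomputable def oTry (n : ℕ) : Module.End ℝ (STF n) :=
  ∑ μ : Fin n, (pderiv (Sum.inr μ)).toLinearMap ∘ₗ (pderiv (Sum.inr μ)).toLinearMap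


section Apply

variable {n : ℕ} (f h : STF n) (i : Fin n)

lemma oGrad_apply : oGrad n f = ∑ μ, X (Sum.inr μ) * pderiv (Sum.inl μ) f := by
  simp [oGrad, LinearMap.sum_apply]

lemma oDiv_apply : oDiv n f = ∑ μ, pderiv (Sum.inr μ) (pderiv (Sum.inl μ) f) := by
  simp [oDiv, LinearMap.sum_apply]

lemma oNy_apply : oNy n f = ∑ μ, X (Sum.inr μ) * pderiv (Sum.inr μ) f := by
  simp [oNy, LinearMap.sum_apply]

lemma oTry_apply : oTry n f = ∑ μ, pderiv (Sum.inr μ) (pderiv (Sum.inr μ) f) := by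
  simp [oTry, LinearMap.sum_apply]

lemma oGy_apply : oGy n f = (∑ μ, X (Sum.inr μ) ^ 2) * f := by
  simp [oGy]

lemma pderiv_comm_apply {σ : Type*} (i j : σ) (f : MvPolynomial σ ℝ) :
    pderiv i (pderiv j f) = pderiv j (pderiv i f) := by
  classical
  have h : ⁅(pderiv i : Derivation ℝ (MvPolynomial σ ℝ) (MvPolynomial σ ℝ)),
      (pderiv j : Derivation ℝ (MvPolynomial σ ℝ) (MvPolynomial σ ℝ))⁆ = 0 := by
    refine MvPolynomial.derivation_ext (fun k => ?_)
    simp [Derivation.commutator_apply, pderiv_X, Pi.single_apply, apply_ite]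
  have := Derivation.congr_fun h f
  simpa [Derivation.commutator_apply, sub_eq_zero] using this

lemma pderiv_inr_oGy :
    pderiv (Sum.inr i) (oGy n f) = (2 : ℝ) • (X (Sum.inr i) * f) + oGy n (pderiv (Sum.inr i) f) := by
  classical
  simp [oGy_apply, Derivation.leibniz, pderiv_X, Pi.single_apply, Derivation.leibniz_pow, smul_eq_C_mul]
  rw [show (C (2 : ℝ) : STF n) = 2 from map_ofNat C 2]
  ring

lemma pderiv_inl_oGy :
    pderiv (Sum.inl i) (oGy n f) = oGy n (pderiv (Sum.inl i) f) := by
  classical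
  simp [oGy_apply, Derivation.leibniz, pderiv_X, Derivation.leibniz_pow]

lemma pderiv_inr_oGrad :
    pderiv (Sum.inr i) (oGrad n f) = pderiv (Sum.inl i) f + oGrad n (pderiv (Sum.inr i) f) := by
  classical
  simp [oGrad_apply, Derivation.leibniz, pderiv_X, Pi.single_apply, sum_add_distrib,
    pderiv_comm_apply (Sum.inr i), add_comm]

lemma pderiv_inr_oNy :
    pderiv (Sum.inr i) (oNy n f) = pderiv (Sum.inr i) f + oNy n (pderiv (Sum.inr i) f) := by
  classical
  simp [oNy_apply, Derivation.leibniz, pderiv_X, Pi.single_apply, sum_add_distrib,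
    pderiv_comm_apply (Sum.inr i), add_comm]

lemma pderiv_inl_oNy :
    pderiv (Sum.inl i) (oNy n f) = oNy n (pderiv (Sum.inl i) f) := by
  classical
  simp [oNy_apply, Derivation.leibniz, pderiv_X, pderiv_comm_apply (Sum.inl i)]

lemma pderiv_inr_oDiv :
    pderiv (Sum.inr i) (oDiv n f) = oDiv n (pderiv (Sum.inr i) f) := by
  simp [oDiv_apply, pderiv_comm_apply (Sum.inr i)]

lemma oGrad_X_inr_mul : oGrad n (X (Sum.inr i) * h) = X (Sum.inr i) * oGrad n h := by
  classical
  simp [oGrad_apply, Derivation.leibniz, pderiv_X, mul_sum, mul_left_comm]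

lemma oTry_oGy : oTry n (oGy n f) = oGy n (oTry n f) + (4 : ℝ) • oNy n f + (2 * n : ℝ) • f := by
  have key (i : Fin n) : pderiv (Sum.inr i) (pderiv (Sum.inr i) (oGy n f)) =
      oGy n (pderiv (Sum.inr i) (pderiv (Sum.inr i) f)) +
        (4 : ℝ) • (X (Sum.inr i) * pderiv (Sum.inr i) f) + (2 : ℝ) • f := by
    simp only [pderiv_inr_oGy, map_add, Derivation.map_smul, Derivation.leibniz, pderiv_X_self,
      smul_eq_mul, mul_one]
    module
  rw [oTry_apply, oTry_apply, oNy_apply]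
  simp only [key, sum_add_distrib, map_sum, smul_sum, sum_const, card_univ, Fintype.card_fin]
  module

lemma oDiv_oGy : oDiv n (oGy n f) = oGy n (oDiv n f) + (2 : ℝ) • oGrad n f := by
  simp only [oDiv_apply, oGrad_apply, pderiv_inl_oGy, pderiv_inr_oGy, sum_add_distrib, map_sum,
    smul_sum, add_comm]

lemma oGrad_oGy : oGrad n (oGy n f) = oGy n (oGrad n f) := by
  simp only [oGrad_apply, pderiv_inl_oGy]
  simp only [oGy_apply, mul_sum _ _ (∑ μ, _), mul_left_comm]

lemma oTry_oGrad : oTry n (oGrad n f) = oGrad n (oTry n f) + (2 : ℝ) • oDiv n f := by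
  simp only [oTry_apply, oDiv_apply, pderiv_inr_oGrad, map_add, sum_add_distrib, map_sum,
    pderiv_comm_apply (Sum.inl _) (Sum.inr _)]
  module

lemma oTry_oDiv : oTry n (oDiv n f) = oDiv n (oTry n f) := by
  simp only [oTry_apply, pderiv_inr_oDiv, map_sum]

lemma oNy_oGy : oNy n (oGy n f) = oGy n (oNy n f) + (2 : ℝ) • oGy n f := by
  simp only [oNy_apply, pderiv_inr_oGy, mul_add, sum_add_distrib, mul_smul_comm, ← smul_sum]
  simp only [oGy_apply, mul_sum _ _ (∑ μ, _), sum_mul _ _ f, mul_left_comm, ← mul_assoc, pow_two]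
  rw [add_comm]

lemma oNy_oGrad : oNy n (oGrad n f) = oGrad n (oNy n f) + oGrad n f := by
  rw [oNy_apply, oNy_apply]
  simp only [pderiv_inr_oGrad, mul_add, sum_add_distrib, map_sum, oGrad_X_inr_mul]
  rw [← oGrad_apply, add_comm]

lemma oNy_oDiv : oNy n (oDiv n f) = oDiv n (oNy n f) - oDiv n f := by
  simp only [oDiv_apply, pderiv_inl_oNy, pderiv_inr_oNy, sum_add_distrib, map_sum]
  abel

lemma oNy_oTry : oNy n (oTry n f) = oTry n (oNy n f) - (2 : ℝ) • oTry n f := by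
  simp only [oTry_apply, pderiv_inr_oNy, sum_add_distrib, map_sum, map_add]
  module

lemma oNy_monomial (m : Fin n ⊕ Fin n →₀ ℕ) (c : ℝ) :
    oNy n (monomial m c) = ((∑ i, m (Sum.inr i) : ℕ) : ℝ) • monomial m c := by
  simp only [oNy_apply, X_mul_pderiv_monomial, ← sum_smul, Nat.cast_smul_eq_nsmul]

lemma coeff_oNy (m : Fin n ⊕ Fin n →₀ ℕ) :
    coeff m (oNy n f) = (∑ i, m (Sum.inr i) : ℕ) * coeff m f := by
  classical
  induction f using MvPolynomial.induction_on' with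
  | monomial u a =>
    rw [oNy_monomial, coeff_smul, coeff_monomial, smul_eq_mul]
    split_ifs with hu
    · rw [hu]
    · simp
  | add p q hp hq => rw [map_add, coeff_add, coeff_add, hp, hq, mul_add]

end Apply

section Harmonic

variable {n : ℕ} {f : STF n}

lemma eq_natCast_of_oNy_eq_smul {s : ℝ} (hf : oNy n f = s • f) (h0 : f ≠ 0) :
    ∃ d : ℕ, s = d := by
  obtain ⟨m, hm⟩ := MvPolynomial.ne_zero_iff.mp h0
  refine ⟨∑ i, m (Sum.inr i), ?_⟩
  have := congrArg (coeff m) hf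
  rw [coeff_oNy, coeff_smul, smul_eq_mul] at this
  exact (mul_right_cancel₀ hm this).symm

lemma oGy_pow_succ_apply (k : ℕ) (f : STF n) : (oGy n ^ (k + 1)) f = oGy n ((oGy n ^ k) f) := by
  rw [pow_succ', Module.End.mul_apply]

lemma oNy_oGy_pow {s : ℝ} (hf : oNy n f = s • f) (k : ℕ) :
    oNy n ((oGy n ^ k) f) = (s + 2 * k) • (oGy n ^ k) f := by
  induction k with
  | zero => simpa using hf
  | succ k ih =>
    rw [oGy_pow_succ_apply, oNy_oGy, ih, map_smul]
    push_cast
    module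

lemma oTry_oGy_pow_succ {s : ℝ} (hf : oNy n f = s • f) (ht : oTry n f = 0) (k : ℕ) :
    oTry n ((oGy n ^ (k + 1)) f) =
      (2 * (k + 1) * (2 * k + 2 * s + n) : ℝ) • (oGy n ^ k) f := by
  induction k with
  | zero =>
    simp only [zero_add, pow_one, oTry_oGy, ht, hf, map_zero, pow_zero, Module.End.one_apply]
    push_cast
    module
  | succ k ih =>
    rw [oGy_pow_succ_apply, oTry_oGy, ih, oNy_oGy_pow hf, map_smul, ← oGy_pow_succ_apply]
    push_cast
    module

lemma oGrad_oGy_pow (k : ℕ) (f : STF n) :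
    oGrad n ((oGy n ^ k) f) = (oGy n ^ k) (oGrad n f) := by
  induction k with
  | zero => simp
  | succ k ih => rw [oGy_pow_succ_apply, oGrad_oGy, ih, oGy_pow_succ_apply]

lemma oDiv_oGy_pow_succ (k : ℕ) (f : STF n) :
    oDiv n ((oGy n ^ (k + 1)) f) =
      (oGy n ^ (k + 1)) (oDiv n f) + (2 * (k + 1) : ℝ) • (oGy n ^ k) (oGrad n f) := by
  induction k with
  | zero => simp [oDiv_oGy]
  | succ k ih =>
    rw [oGy_pow_succ_apply, oDiv_oGy, ih, oGrad_oGy_pow, map_add, map_smul,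
      ← oGy_pow_succ_apply, ← oGy_pow_succ_apply]
    push_cast
    module

/-- The span of the tensor fields `g ^ k Φ` of degree `d` in `y`, with `Φ` traceless. -/
noncomputable def fischerSpan (n d : ℕ) : Submodule ℝ (STF n) :=
  Submodule.span ℝ {f | ∃ (s k : ℕ) (φ : STF n), oNy n φ = (s : ℝ) • φ ∧ oTry n φ = 0 ∧
    s + 2 * k = d ∧ f = (oGy n ^ k) φ}

lemma oNy_of_mem_fischerSpan {d : ℕ} (hf : f ∈ fischerSpan n d) : oNy n f = (d : ℝ) • f := by
  induction hf using Submodule.span_induction with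
  | mem f hf =>
    obtain ⟨s, k, φ, hφ, -, rfl, rfl⟩ := hf
    rw [oNy_oGy_pow hφ]
    push_cast
    rfl
  | zero => simp
  | add x y _ _ hx hy => rw [map_add, hx, hy, smul_add]
  | smul c x _ hx => rw [map_smul, hx, smul_comm]

lemma exists_oTry_eq_of_mem_fischerSpan (hn : 0 < n) {d : ℕ} (hf : f ∈ fischerSpan n d) :
    ∃ h ∈ fischerSpan n (d + 2), oTry n h = f := by
  induction hf using Submodule.span_induction with
  | mem f hf =>
    obtain ⟨s, k, φ, hφ, ht, rfl, rfl⟩ := hf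
    refine ⟨(2 * (k + 1) * (2 * k + 2 * s + n) : ℝ)⁻¹ • (oGy n ^ (k + 1)) φ,
      Submodule.smul_mem _ _ (Submodule.subset_span ⟨s, k + 1, φ, hφ, ht, by ring, rfl⟩), ?_⟩
    have : (2 * (k + 1) * (2 * k + 2 * s + n) : ℝ) ≠ 0 := by positivity
    rw [map_smul, oTry_oGy_pow_succ hφ ht, inv_smul_smul₀ this]
  | zero => exact ⟨0, Submodule.zero_mem _, map_zero _⟩
  | add x y _ _ hx hy =>
    obtain ⟨a, ha, rfl⟩ := hx
    obtain ⟨b, hb, rfl⟩ := hy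
    exact ⟨a + b, Submodule.add_mem _ ha hb, map_add _ _ _⟩
  | smul c x _ hx =>
    obtain ⟨a, ha, rfl⟩ := hx
    exact ⟨c • a, Submodule.smul_mem _ _ ha, map_smul _ _ _⟩

lemma mem_fischerSpan_of_oNy (hn : 0 < n) {d : ℕ} (hf : oNy n f = (d : ℝ) • f) :
    f ∈ fischerSpan n d := by
  induction d using Nat.strong_induction_on generalizing f with
  | _ d ih =>
    have harm {φ : STF n} (hφ : oNy n φ = (d : ℝ) • φ) (ht : oTry n φ = 0) :
        φ ∈ fischerSpan n d :=
      Submodule.subset_span ⟨d, 0, φ, hφ, ht, by simp, by simp⟩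
    by_cases h0 : oTry n f = 0
    · exact harm hf h0
    have htr : oNy n (oTry n f) = ((d : ℝ) - 2) • oTry n f := by
      rw [oNy_oTry, hf, map_smul, sub_smul]
    obtain ⟨e, he⟩ := eq_natCast_of_oNy_eq_smul htr h0
    obtain rfl : d = e + 2 := by
      have : (d : ℝ) = e + 2 := by linarith
      exact_mod_cast this
    rw [he] at htr
    obtain ⟨h, hh, hhf⟩ := exists_oTry_eq_of_mem_fischerSpan hn (ih e (by omega) htr)
    have := harm (φ := f - h) (by rw [map_sub, hf, oNy_of_mem_fischerSpan hh, smul_sub])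
      (by rw [map_sub, hhf, sub_self])
    simpa using Submodule.add_mem _ this hh

/-- The Fischer decomposition: endomorphisms agreeing on all `g ^ k Φ`, with `Φ` traceless and
homogeneous in `y`, are equal. -/
lemma end_ext_of_traceless (hn : 0 < n) {S T : Module.End ℝ (STF n)}
    (h : ∀ (s k : ℕ) (φ : STF n), oNy n φ = (s : ℝ) • φ → oTry n φ = 0 →
      S ((oGy n ^ k) φ) = T ((oGy n ^ k) φ)) : S = T := by
  have key (m : Fin n ⊕ Fin n →₀ ℕ) (c : ℝ) : S (monomial m c) = T (monomial m c) := by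
    refine LinearMap.eqOn_span (fun f hf => ?_) (mem_fischerSpan_of_oNy hn (oNy_monomial m c))
    obtain ⟨s, k, φ, hφ, ht, -, rfl⟩ := hf
    exact h s k φ hφ ht
  refine LinearMap.ext fun f => ?_
  induction f using MvPolynomial.induction_on' with
  | monomial u a => exact key u a
  | add p q hp hq => rw [map_add, map_add, hp, hq]

lemma apply_eq_inv_smul {V : Type*} [AddCommGroup V] [Module ℝ V] {S T : Module.End ℝ V}
    (h : T * S = 1) {v : V} {c : ℝ} (hc : c ≠ 0) (hv : S v = c • v) : T v = c⁻¹ • v := by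
  have := congrArg (fun R : Module.End ℝ V => R v) h
  simp only [Module.End.mul_apply, hv, map_smul, Module.End.one_apply] at this
  rw [← this, smul_smul, inv_mul_cancel₀ hc, one_smul, this]

end Harmonic

/-- recovering the original operators,
`grad = (1/2)((𝒩+𝒞−3)/(𝒞−1))∘grad~ + (1/(2𝒞))((𝒩+𝒞−3)/(𝒩+𝒞−1))∘g∘div~` and
`div = (1/2)∘div~∘((𝒩+𝒞−3)/(𝒞−1)) + (1/2)∘grad~∘tr∘((𝒩+𝒞−3)/(𝒞(𝒩+𝒞−1)))`,
rational functions realized via inverses `E` of `𝒩+𝒞−1`, `EC` of `𝒞`, `EC1` of `𝒞−1`. -/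
theorem stmt17 (n : ℕ) (hn : 5 ≤ n)
    (C E EC EC1 : Module.End ℝ (STF n))
    (hC : ∀ (s k : ℕ) (φ : STF n), oNy n φ = (s : ℝ) • φ → oTry n φ = 0 →
      C ((oGy n ^ k) φ) = ((s : ℝ) + ((n : ℝ) - 2) / 2) • (oGy n ^ k) φ)
    (hE : (oNy n + ((n : ℝ) / 2) • 1 + C - 1) * E = 1 ∧
          E * (oNy n + ((n : ℝ) / 2) • 1 + C - 1) = 1)
    (hEC : C * EC = 1 ∧ EC * C = 1)
    (hEC1 : (C - 1) * EC1 = 1 ∧ EC1 * (C - 1) = 1) :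
    let NN : Module.End ℝ (STF n) := oNy n + ((n : ℝ) / 2) • 1
    let gradT : Module.End ℝ (STF n) := oGrad n - oGy n * oDiv n * E
    let divT : Module.End ℝ (STF n) := oDiv n - E * oGrad n * oTry n
    oGrad n = ((1 : ℝ) / 2) • ((NN + C - 3) * EC1 * gradT) +
              ((1 : ℝ) / 2) • (EC * ((NN + C - 3) * E) * oGy n * divT) ∧
    oDiv n = ((1 : ℝ) / 2) • (divT * ((NN + C - 3) * EC1)) +
             ((1 : ℝ) / 2) • (gradT * oTry n * ((NN + C - 3) * EC * E)) := by
  intro NN gradT divT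
  have hn' : (5 : ℝ) ≤ n := by exact_mod_cast hn
  have hn0 : 0 < n := by omega
  have hCr {r : ℝ} {f : STF n} (hf : oNy n f = r • f) (ht : oTry n f = 0) (k : ℕ) :
      C ((oGy n ^ k) f) = (r + ((n : ℝ) - 2) / 2) • (oGy n ^ k) f := by
    rcases eq_or_ne f 0 with rfl | h0
    · simp
    · obtain ⟨d, rfl⟩ := eq_natCast_of_oNy_eq_smul hf h0
      exact hC d k f hf ht
  have hEr {r : ℝ} {f : STF n} (hf : oNy n f = r • f) (ht : oTry n f = 0) (k : ℕ)
      (h0 : 2 * r + 2 * k + n - 2 ≠ 0) :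
      E ((oGy n ^ k) f) = (2 * r + 2 * k + n - 2)⁻¹ • (oGy n ^ k) f := by
    refine apply_eq_inv_smul hE.2 h0 ?_
    simp only [LinearMap.sub_apply, LinearMap.add_apply, LinearMap.smul_apply,
      Module.End.one_apply, oNy_oGy_pow hf, hCr hf ht]
    module
  have hECr {r : ℝ} {f : STF n} (hf : oNy n f = r • f) (ht : oTry n f = 0) (k : ℕ)
      (h0 : r + ((n : ℝ) - 2) / 2 ≠ 0) :
      EC ((oGy n ^ k) f) = (r + ((n : ℝ) - 2) / 2)⁻¹ • (oGy n ^ k) f :=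
    apply_eq_inv_smul hEC.2 h0 (hCr hf ht k)
  have hEC1r {r : ℝ} {f : STF n} (hf : oNy n f = r • f) (ht : oTry n f = 0) (k : ℕ)
      (h0 : r + ((n : ℝ) - 2) / 2 - 1 ≠ 0) :
      EC1 ((oGy n ^ k) f) = (r + ((n : ℝ) - 2) / 2 - 1)⁻¹ • (oGy n ^ k) f := by
    refine apply_eq_inv_smul hEC1.2 h0 ?_
    rw [LinearMap.sub_apply, hCr hf ht, Module.End.one_apply]
    module
  have hNC {r : ℝ} {f : STF n} (hf : oNy n f = r • f) (ht : oTry n f = 0) (k : ℕ) :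
      (NN + C - 3) ((oGy n ^ k) f) = (2 * r + 2 * k + n - 4) • (oGy n ^ k) f := by
    simp only [NN, LinearMap.sub_apply, LinearMap.add_apply, LinearMap.smul_apply,
      Module.End.one_apply, Module.End.ofNat_apply, oNy_oGy_pow hf, hCr hf ht]
    module
  have grad_div (s : ℕ) (φ : STF n) (hφ : oNy n φ = (s : ℝ) • φ) (ht : oTry n φ = 0) :
      ∃ A B : STF n,
        oNy n A = (s + 1 : ℝ) • A ∧ oTry n A = 0 ∧ oNy n B = (s - 1 : ℝ) • B ∧ oTry n B = 0 ∧
        oDiv n φ = B ∧ oGrad n φ = A + (2 * s + n - 2 : ℝ)⁻¹ • oGy n B := by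
    have h0 : (2 * s + n - 2 : ℝ) ≠ 0 := by
      have : (0 : ℝ) ≤ s := s.cast_nonneg
      linarith
    have hB : oNy n (oDiv n φ) = (s - 1 : ℝ) • oDiv n φ := by
      rw [oNy_oDiv, hφ, map_smul]
      module
    have hBt : oTry n (oDiv n φ) = 0 := by rw [oTry_oDiv, ht, map_zero]
    refine ⟨oGrad n φ - (2 * s + n - 2 : ℝ)⁻¹ • oGy n (oDiv n φ), oDiv n φ, ?_, ?_, hB, hBt, rfl,
      by abel⟩
    · rw [map_sub, map_smul, oNy_oGrad, oNy_oGy, hB, hφ, map_smul, map_smul]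
      module
    · rw [map_sub, map_smul, oTry_oGrad, oTry_oGy, hB, hBt, ht, map_zero, map_zero]
      match_scalars
      field_simp
      ring
  have gen (s k : ℕ) (φ : STF n) (hφ : oNy n φ = (s : ℝ) • φ) (ht : oTry n φ = 0) :
      oGrad n ((oGy n ^ k) φ) = (((1 : ℝ) / 2) • ((NN + C - 3) * EC1 * gradT) +
        ((1 : ℝ) / 2) • (EC * ((NN + C - 3) * E) * oGy n * divT)) ((oGy n ^ k) φ) ∧
      oDiv n ((oGy n ^ k) φ) = (((1 : ℝ) / 2) • (divT * ((NN + C - 3) * EC1)) +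
        ((1 : ℝ) / 2) • (gradT * oTry n * ((NN + C - 3) * EC * E))) ((oGy n ^ k) φ) := by
    obtain ⟨A, B, hA, hAt, hB, hBt, hdiv, hgrad⟩ := grad_div s φ hφ ht
    have hs : (0 : ℝ) ≤ s := s.cast_nonneg
    have hj (j : ℕ) : (0 : ℝ) ≤ j := j.cast_nonneg
    obtain ⟨a, ha⟩ : ∃ a : ℝ, 2 * s + n - 2 = a := ⟨_, rfl⟩
    obtain ⟨t, rfl⟩ : ∃ t : ℝ, a = t + 2 := ⟨a - 2, by ring⟩
    have ht0 : 0 < t := by linarith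
    have hta : t + 2 ≠ 0 := by linarith
    have hn_eq : (n : ℝ) = t + 4 - 2 * s := by linarith
    rw [ha] at hgrad
    have EΦ (j : ℕ) : E ((oGy n ^ j) φ) = (t + 2 + 2 * j)⁻¹ • (oGy n ^ j) φ := by
      rw [hEr hφ ht j (by linarith [hj j]), hn_eq]
      ring_nf
    have EA (j : ℕ) : E ((oGy n ^ j) A) = (t + 4 + 2 * j)⁻¹ • (oGy n ^ j) A := by
      rw [hEr hA hAt j (by linarith [hj j]), hn_eq]
      ring_nf
    have EB (j : ℕ) : E ((oGy n ^ j) B) = (t + 2 * j)⁻¹ • (oGy n ^ j) B := by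
      rw [hEr hB hBt j (by linarith [hj j]), hn_eq]
      ring_nf
    have ECΦ (j : ℕ) : EC ((oGy n ^ j) φ) = (2 / (t + 2)) • (oGy n ^ j) φ := by
      rw [hECr hφ ht j (by linarith), hn_eq, ← inv_div (t + 2) 2]
      ring_nf
    have ECB (j : ℕ) : EC ((oGy n ^ j) B) = (2 / t) • (oGy n ^ j) B := by
      rw [hECr hB hBt j (by linarith), hn_eq, ← inv_div t 2]
      ring_nf
    have EC1Φ (j : ℕ) : EC1 ((oGy n ^ j) φ) = (2 / t) • (oGy n ^ j) φ := by
      rw [hEC1r hφ ht j (by linarith), hn_eq, ← inv_div t 2]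
      ring_nf
    have EC1A (j : ℕ) : EC1 ((oGy n ^ j) A) = (2 / (t + 2)) • (oGy n ^ j) A := by
      rw [hEC1r hA hAt j (by linarith), hn_eq, ← inv_div (t + 2) 2]
      ring_nf
    have NΦ (j : ℕ) : (NN + C - 3) ((oGy n ^ j) φ) = (t + 2 * j) • (oGy n ^ j) φ := by
      rw [hNC hφ ht, hn_eq]
      ring_nf
    have NA (j : ℕ) : (NN + C - 3) ((oGy n ^ j) A) = (t + 2 + 2 * j) • (oGy n ^ j) A := by
      rw [hNC hA hAt, hn_eq]
      ring_nf
    have NB (j : ℕ) : (NN + C - 3) ((oGy n ^ j) B) = (t - 2 + 2 * j) • (oGy n ^ j) B := by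
      rw [hNC hB hBt, hn_eq]
      ring_nf
    have gpow (j : ℕ) (f : STF n) : (oGy n ^ j) (oGy n f) = (oGy n ^ (j + 1)) f := by
      rw [pow_succ, Module.End.mul_apply]
    have gsucc (j : ℕ) (f : STF n) : oGy n ((oGy n ^ j) f) = (oGy n ^ (j + 1)) f :=
      (oGy_pow_succ_apply j f).symm
    have grad_pow (j : ℕ) : oGrad n ((oGy n ^ j) φ) =
        (oGy n ^ j) A + (t + 2)⁻¹ • (oGy n ^ (j + 1)) B := by
      rw [oGrad_oGy_pow, hgrad, map_add, map_smul, gpow]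
    have div_succ (j : ℕ) : oDiv n ((oGy n ^ (j + 1)) φ) = (2 * (j + 1) : ℝ) • (oGy n ^ j) A +
        (1 + 2 * (j + 1) / (t + 2)) • (oGy n ^ (j + 1)) B := by
      rw [oDiv_oGy_pow_succ, ← oGrad_oGy_pow, grad_pow, hdiv]
      module
    have div_base : oDiv n ((oGy n ^ 0) φ) = (oGy n ^ 0) B := hdiv
    have tr_succ (j : ℕ) : oTry n ((oGy n ^ (j + 1)) φ) =
        (2 * (j + 1) * (t + 4 + 2 * j)) • (oGy n ^ j) φ := by
      rw [oTry_oGy_pow_succ hφ ht, hn_eq]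
      ring_nf
    have tr_base : oTry n ((oGy n ^ 0) φ) = 0 := ht
    have p0 (j : ℕ) : t + 2 * j ≠ 0 := by linarith [hj j]
    have p2 (j : ℕ) : t + 2 + 2 * j ≠ 0 := by linarith [hj j]
    have p4 (j : ℕ) : t + 4 + 2 * j ≠ 0 := by linarith [hj j]
    have gradT_pow (j : ℕ) : gradT ((oGy n ^ j) φ) =
        ((t + 2) / (t + 2 + 2 * j)) • (oGy n ^ j) A := by
      have h := p2 j
      simp only [gradT, LinearMap.sub_apply, Module.End.mul_apply, EΦ, map_smul, grad_pow]
      cases j with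
      | zero =>
        simp only [div_base, gsucc]
        push_cast at h ⊢
        match_scalars <;> field_simp <;> ring
      | succ j =>
        simp only [div_succ, map_add, map_smul, gsucc]
        push_cast at h ⊢
        match_scalars <;> field_simp <;> ring
    have divT_pow (j : ℕ) : divT ((oGy n ^ j) φ) =
        (t * (t + 2 + 2 * j) / ((t + 2) * (t + 2 * j))) • (oGy n ^ j) B := by
      have h := p0 j
      simp only [divT, LinearMap.sub_apply, Module.End.mul_apply]
      cases j with
      | zero =>
        simp only [div_base, tr_base, map_zero]
        match_scalars
        simp only [mul_zero, add_zero]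
        field_simp
      | succ j =>
        have h' := p4 j
        simp only [div_succ, tr_succ, map_add, map_smul, grad_pow, EA, EB]
        push_cast at h ⊢
        match_scalars <;> field_simp <;> ring
    have h0 := p0 k
    have h2 := p2 k
    constructor
    · simp only [LinearMap.add_apply, LinearMap.smul_apply, Module.End.mul_apply (M := STF n),
        gradT_pow, divT_pow, map_smul, gsucc, EB, EC1A, ECB, NA, NB, grad_pow]
      push_cast
      have h2' : t + 2 * (k + 1) ≠ 0 := by linarith
      match_scalars <;> field_simp
      ring
    · simp only [LinearMap.add_apply, LinearMap.smul_apply, Module.End.mul_apply (M := STF n),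
        divT_pow, map_smul, EΦ, EC1Φ, ECΦ, NΦ]
      cases k with
      | zero =>
        simp only [div_base, tr_base, map_zero]
        match_scalars
        simp only [mul_zero, add_zero]
        field_simp
      | succ k =>
        have h4 := p4 k
        have h2' := p2 k
        simp only [div_succ, tr_succ, map_smul, gradT_pow]
        push_cast at h0 h2 ⊢
        match_scalars <;> field_simp
        ring
  exact ⟨end_ext_of_traceless hn0 fun s k φ hφ ht => (gen s k φ hφ ht).1,
    end_ext_of_traceless hn0 fun s k φ hφ ht => (gen s k φ hφ ht).2⟩
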